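/- Let n ≥ m ≥ 0 be integers and let ν be an integer with 1 ≤ ν ≤ n. Then the derivative of t ↦ R_{n,m}(t+n-m) at t = ν equals (-1)^m · (ν + n - m + n/2) · ((ν-m)_m/m!) · ((-1)^{n-ν}(ν+n-m-1)!(n-ν)!/(2n-m)!) · ((ν+2n-m+1)_n/(ν+n-m)_{n+1}) · ((ν+2n-m+1)_{2n-m}/(ν+n-m)_{2n-m+1}) · (n!/(ν+n-m)_{n+1})². In particular, this derivative vanishes for 1 ≤ ν ≤ m because of the factor (ν-m)_m. -/

import Mathlib

open scoped BigOperators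

/-- The Pochhammer symbol `(x)_k = x (x+1) ⋯ (x+k-1)` for a real `x`. -/
noncomputable def poch (x : ℝ) (k : ℕ) : ℝ := ∏ i ∈ Finset.range k, (x + i)

/-- The rational function `R_{n,m}(t)` from the paper. -/
noncomputable def R (n m : ℕ) (t : ℝ) : ℝ :=
  (-1 : ℝ) ^ m * (t + n / 2) * (poch (t - n) m / m.factorial) *
    (poch (t - 2 * n + m) (2 * n - m) / (2 * n - m).factorial) *
    (poch (t + n + 1) n / poch t (n + 1)) *
    (poch (t + n + 1) (2 * n - m) / poch t (2 * n - m + 1)) *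
    ((n.factorial : ℝ) / poch t (n + 1)) ^ 2

/-- The rational function `R̃_{n,m}(t)` from the paper. -/
noncomputable def Rtilde (n m : ℕ) (t : ℝ) : ℝ :=
  ((n.factorial : ℝ) * poch (t - n) (2 * n - m) / (poch t (n + 1) * poch t (2 * n - m + 1))) *
    ∑ j ∈ Finset.range (n + 1),
      (n.choose j : ℝ) ^ 2 * ((2 * n - m + j).choose n : ℝ) * poch (t - j) n / n.factorial

/-- `Z_l(n,m) = -(1/3) Σ_{ν=n-m+1}^∞ (d/dt R_{n,m}(t))|_{t=ν}`. -/
noncomputable def Zl (n m : ℕ) : ℝ :=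
  -(1 / 3) * ∑' ν : ℕ, deriv (R n m) ((n : ℝ) - m + 1 + ν)

/-- `Z_r(n,m) = (1/6) Σ_{ν=1}^∞ (d²/dt² R̃_{n,m}(t))|_{t=ν}`. -/
noncomputable def Zr (n m : ℕ) : ℝ :=
  (1 / 6) * ∑' ν : ℕ, deriv (deriv (Rtilde n m)) (1 + (ν : ℝ))

/-- `U_k(n) = Σ_{i=0}^n C(4i,2i) / ((2i+1)^k C(2i,i)^8)`. -/
noncomputable def U (k n : ℕ) : ℝ :=
  ∑ i ∈ Finset.range (n + 1),
    ((4 * i).choose (2 * i) : ℝ) / ((2 * i + 1) ^ k * ((2 * i).choose i : ℝ) ^ 8)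

/-- The harmonic number `S₁(N) = Σ_{i=1}^N 1/i`. -/
noncomputable def S1 (N : ℕ) : ℝ := ∑ i ∈ Finset.range N, (1 : ℝ) / (i + 1)

theorem poch_succ (x : ℝ) (k : ℕ) : poch x (k + 1) = poch x k * (x + k) :=
  Finset.prod_range_succ _ _

theorem poch_add (x : ℝ) (k l : ℕ) : poch x (k + l) = poch x k * poch (x + k) l := by
  simp only [poch, Finset.prod_range_add, Nat.cast_add, add_assoc]

theorem poch_pos {x : ℝ} (hx : 0 < x) (k : ℕ) : 0 < poch x k :=
  Finset.prod_pos fun i _ => by positivity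

theorem poch_one (k : ℕ) : poch 1 k = k.factorial := by
  induction k with
  | zero => simp [poch]
  | succ k ih =>
    rw [poch_succ, ih, Nat.factorial_succ]
    push_cast
    ring

theorem poch_neg_natCast (k : ℕ) : poch (-(k : ℝ)) k = (-1) ^ k * k.factorial := by
  have hpow : (-1 : ℝ) ^ k = ∏ _i ∈ Finset.range k, (-1 : ℝ) := by simp
  rw [← poch_one, poch, poch, ← Finset.prod_range_reflect, hpow, ← Finset.prod_mul_distrib]
  refine Finset.prod_congr rfl fun i hi => ?_
  have hi' : i + 1 ≤ k := Finset.mem_range.mp hi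
  rw [Nat.sub_sub, Nat.cast_sub (by omega)]
  push_cast
  ring

theorem poch_natCast_sub_eq_zero {a m : ℕ} (ha : 1 ≤ a) (ham : a ≤ m) :
    poch ((a : ℝ) - m) m = 0 := by
  refine Finset.prod_eq_zero (i := m - a) (Finset.mem_range.mpr (by omega)) ?_
  rw [Nat.cast_sub ham]
  ring

theorem differentiable_poch (k : ℕ) : Differentiable ℝ fun x : ℝ => poch x k := by
  unfold poch
  fun_prop

/-- At a zero `-k` of the Pochhammer symbol `(x)_{k+1+l}` only one term of the product rule
survives. -/
theorem hasDerivAt_poch_neg_natCast (k l : ℕ) :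
    HasDerivAt (fun x : ℝ => poch x (k + 1 + l))
      ((-1) ^ k * l.factorial * k.factorial) (-(k : ℝ)) := by
  have hfun : (fun x : ℝ => poch x (k + 1 + l)) =
      fun x => (x + k) * (poch x k * poch (x + (k + 1 : ℕ)) l) := by
    funext x
    rw [poch_add, poch_succ]
    ring
  have hd : DifferentiableAt ℝ
      (fun x : ℝ => poch x k * poch (x + (k + 1 : ℕ)) l) (-(k : ℝ)) :=
    ((differentiable_poch k).mul
      ((differentiable_poch l).comp (differentiable_id.add_const _))).differentiableAt
  rw [hfun]
  refine (((hasDerivAt_id _).add_const (k : ℝ)).mul hd.hasDerivAt).congr_deriv ?_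
  have h1 : -(k : ℝ) + (k + 1 : ℕ) = 1 := by push_cast; ring
  simp only [id, h1, poch_one, poch_neg_natCast]
  ring

/-- The product rule at a zero of the first factor. -/
theorem HasDerivAt.mul_of_eq_zero {f g : ℝ → ℝ} {f' x : ℝ} (hf : HasDerivAt f f' x)
    (hx : f x = 0) (hg : DifferentiableAt ℝ g x) :
    HasDerivAt (fun t => f t * g t) (f' * g x) x :=
  (hf.mul hg.hasDerivAt).congr_deriv (by rw [hx]; ring)

/-- The explicit evaluation of the derivative of `t ↦ R_{n,m}(t+n-m)` at `t = ν` for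
`1 ≤ ν ≤ n`; in particular it vanishes for `1 ≤ ν ≤ m` because of the factor `(ν-m)_m`. -/
theorem deriv_R_shifted (n m ν : ℕ) (hmn : m ≤ n) (hν1 : 1 ≤ ν) (hνn : ν ≤ n) :
    deriv (fun t : ℝ => R n m (t + n - m)) (ν : ℝ) =
      (-1 : ℝ) ^ m * ((ν : ℝ) + n - m + n / 2) * (poch ((ν : ℝ) - m) m / m.factorial) *
        ((-1 : ℝ) ^ (n - ν) * ((ν + n - m - 1).factorial : ℝ) * ((n - ν).factorial : ℝ) /
          ((2 * n - m).factorial : ℝ)) *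
        (poch ((ν : ℝ) + 2 * n - m + 1) n / poch ((ν : ℝ) + n - m) (n + 1)) *
        (poch ((ν : ℝ) + 2 * n - m + 1) (2 * n - m) / poch ((ν : ℝ) + n - m) (2 * n - m + 1)) *
        ((n.factorial : ℝ) / poch ((ν : ℝ) + n - m) (n + 1)) ^ 2 ∧
    (ν ≤ m → deriv (fun t : ℝ => R n m (t + n - m)) (ν : ℝ) = 0) := by
  have hmn' : (m : ℝ) ≤ n := by exact_mod_cast hmn
  have hν1' : (1 : ℝ) ≤ ν := by exact_mod_cast hν1
  have hpos : (0 : ℝ) < (ν : ℝ) + n - m := by linarith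
  have hN : n - ν + 1 + (ν + n - m - 1) = 2 * n - m := by omega
  have hP : HasDerivAt (fun t : ℝ => poch (t - n) (2 * n - m))
      ((-1) ^ (n - ν) * (ν + n - m - 1).factorial * (n - ν).factorial) (ν : ℝ) := by
    have h := hasDerivAt_poch_neg_natCast (n - ν) (ν + n - m - 1)
    rw [hN, Nat.cast_sub hνn, neg_sub] at h
    exact h.comp_sub_const (ν : ℝ) (n : ℝ)
  have hP0 : poch ((ν : ℝ) - n) (2 * n - m) = 0 := by
    rw [show 2 * n - m = n + (n - m) by omega, poch_add, poch_natCast_sub_eq_zero hν1 hνn,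
      zero_mul]
  have hne (k : ℕ) : poch ((ν : ℝ) + (n - m)) k ≠ 0 :=
    (poch_pos (by linarith) k).ne'
  have hG : DifferentiableAt ℝ (fun t : ℝ =>
      (-1 : ℝ) ^ m * (t + (n - m + n / 2)) * (poch (t + -m) m / m.factorial) *
        (1 / (2 * n - m).factorial) *
        (poch (t + (2 * n - m + 1)) n / poch (t + (n - m)) (n + 1)) *
        (poch (t + (2 * n - m + 1)) (2 * n - m) / poch (t + (n - m)) (2 * n - m + 1)) *
        ((n.factorial : ℝ) / poch (t + (n - m)) (n + 1)) ^ 2) (ν : ℝ) := by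
    have hd (k : ℕ) (c x : ℝ) : DifferentiableAt ℝ (fun t : ℝ => poch (t + c) k) x :=
      ((differentiable_poch k).comp (differentiable_id.add_const c)).differentiableAt
    have hq {f : ℝ → ℝ} (hf : DifferentiableAt ℝ f ν) (k : ℕ) :
        DifferentiableAt ℝ (fun t => f t / poch (t + (n - m)) k) (ν : ℝ) :=
      hf.fun_div (hd _ _ _) (hne k)
    exact ((((((differentiableAt_id.add_const _).const_mul _).mul
      ((hd _ _ _).div_const _)).mul_const _).mul (hq (hd _ _ _) _)).mul
      (hq (hd _ _ _) _)).mul ((hq (differentiableAt_const _) _).pow 2)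
  have key := (hP.mul_of_eq_zero hP0 hG).deriv
  have hfun : (fun t : ℝ => R n m (t + n - m)) = fun t : ℝ =>
      poch (t - n) (2 * n - m) *
      ((-1 : ℝ) ^ m * (t + (n - m + n / 2)) * (poch (t + -m) m / m.factorial) *
        (1 / (2 * n - m).factorial) *
        (poch (t + (2 * n - m + 1)) n / poch (t + (n - m)) (n + 1)) *
        (poch (t + (2 * n - m + 1)) (2 * n - m) / poch (t + (n - m)) (2 * n - m + 1)) *
        ((n.factorial : ℝ) / poch (t + (n - m)) (n + 1)) ^ 2) := by
    funext t
    rw [R, show t + n - m - n = t + -(m : ℝ) by ring,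
      show t + n - m - 2 * n + m = t - (n : ℝ) by ring,
      show t + n - m + n + 1 = t + (2 * (n : ℝ) - m + 1) by ring,
      show t + n - m = t + ((n : ℝ) - m) by ring]
    ring
  rw [← hfun] at key
  have main : deriv (fun t : ℝ => R n m (t + n - m)) (ν : ℝ) = _ := key
  rw [show (ν : ℝ) + -(m : ℝ) = ν - m by ring,
    show (ν : ℝ) + (2 * (n : ℝ) - m + 1) = ν + 2 * n - m + 1 by ring,
    show (ν : ℝ) + ((n : ℝ) - m) = ν + n - m by ring] at main
  refine ⟨by rw [main]; ring, fun hνm => ?_⟩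
  rw [main, poch_natCast_sub_eq_zero hν1 hνm]
  ring
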